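/- Every odd superderivation D of SL^{n,m} has the form: D(x_1) = Σ_{k=2}^m a_k y_k, D(x_i) = 0 for 2 ≤ i ≤ n, D(y_j) = 0 for 1 ≤ j ≤ m, D(t_1) = Σ_{k=1}^{m-1} k a_{k+1} y_k + m h_m y_m, D(t_2) = 0, D(t_3) = Σ_{k=1}^{m-1} a_{k+1} y_k + h_m y_m, for scalars a_2,...,a_m, h_m; moreover D = -Σ_{k=1}^{m-1} a_{k+1}·ad(y_k) - h_m·ad(y_m), so all odd superderivations of SL^{n,m} are inner and dim Der_1(SL^{n,m}) = m. -/

import Mathlib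

namespace SolvableModelFiliform

/-- Index type of `SL^{n,m}`: `x`-indices, then `t`-indices, then `y`-indices (0-based). -/
abbrev Idx (n m : ℕ) := Fin n ⊕ (Fin 3 ⊕ Fin m)

/-- Underlying vector space over ℂ. -/
abbrev V (n m : ℕ) := Idx n m →₀ ℂ

/-- `X n m k` is the basis vector `x_k` (1-based), or `0` if out of range. -/
noncomputable def X (n m k : ℕ) : V n m :=
  if h : 1 ≤ k ∧ k ≤ n then Finsupp.single (Sum.inl ⟨k - 1, by omega⟩) 1 else 0

/-- `T n m s` is the basis vector `t_s` (`s ∈ {1,2,3}`), or `0` if out of range. -/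
noncomputable def T (n m s : ℕ) : V n m :=
  if h : 1 ≤ s ∧ s ≤ 3 then Finsupp.single (Sum.inr (Sum.inl ⟨s - 1, by omega⟩)) 1 else 0

/-- `Y n m k` is the basis vector `y_k` (1-based), or `0` if out of range. -/
noncomputable def Y (n m k : ℕ) : V n m :=
  if h : 1 ≤ k ∧ k ≤ m then Finsupp.single (Sum.inr (Sum.inr ⟨k - 1, by omega⟩)) 1 else 0

/-- Structure constants of `SL^{n,m}`:
`[x_1,x_i] = x_{i+1}` (2 ≤ i ≤ n-1), `[x_1,y_j] = y_{j+1}` (1 ≤ j ≤ m-1),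
`[t_1,x_i] = i x_i`, `[t_1,y_j] = j y_j`, `[t_2,x_i] = x_i` (2 ≤ i ≤ n),
`[t_3,y_j] = y_j`, extended skew-symmetrically. -/
noncomputable def c (n m : ℕ) : Idx n m → Idx n m → V n m
  | Sum.inl i, Sum.inl j =>
      if i.val = 0 ∧ 1 ≤ j.val then X n m (j.val + 2)
      else if j.val = 0 ∧ 1 ≤ i.val then -X n m (i.val + 2) else 0
  | Sum.inl i, Sum.inr (Sum.inr j) => if i.val = 0 then Y n m (j.val + 2) else 0
  | Sum.inr (Sum.inr j), Sum.inl i => if i.val = 0 then -Y n m (j.val + 2) else 0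
  | Sum.inr (Sum.inl s), Sum.inl i =>
      if s.val = 0 then ((i.val + 1 : ℕ) : ℂ) • X n m (i.val + 1)
      else if s.val = 1 ∧ 1 ≤ i.val then X n m (i.val + 1) else 0
  | Sum.inl i, Sum.inr (Sum.inl s) =>
      -(if s.val = 0 then ((i.val + 1 : ℕ) : ℂ) • X n m (i.val + 1)
        else if s.val = 1 ∧ 1 ≤ i.val then X n m (i.val + 1) else 0)
  | Sum.inr (Sum.inl s), Sum.inr (Sum.inr j) =>
      if s.val = 0 then ((j.val + 1 : ℕ) : ℂ) • Y n m (j.val + 1)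
      else if s.val = 2 then Y n m (j.val + 1) else 0
  | Sum.inr (Sum.inr j), Sum.inr (Sum.inl s) =>
      -(if s.val = 0 then ((j.val + 1 : ℕ) : ℂ) • Y n m (j.val + 1)
        else if s.val = 2 then Y n m (j.val + 1) else 0)
  | Sum.inr (Sum.inl _), Sum.inr (Sum.inl _) => 0
  | Sum.inr (Sum.inr _), Sum.inr (Sum.inr _) => 0

/-- The bracket of `SL^{n,m}`, as a bilinear map. -/
noncomputable def brL (n m : ℕ) : V n m →ₗ[ℂ] V n m →ₗ[ℂ] V n m :=
  Finsupp.lsum ℂ (fun a =>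
    LinearMap.toSpanSingleton ℂ (V n m →ₗ[ℂ] V n m)
      (Finsupp.lsum ℂ (fun b => LinearMap.toSpanSingleton ℂ (V n m) (c n m a b))))

/-- The bracket. -/
noncomputable def br (n m : ℕ) (u v : V n m) : V n m := brL n m u v

/-- Parity of the basis indices (`x`'s and `t`'s even, `y`'s odd). -/
def par (n m : ℕ) : Idx n m → ZMod 2 :=
  Sum.elim (fun _ => 0) (Sum.elim (fun _ => 0) (fun _ => 1))

/-- `u` is homogeneous of degree `s`. -/
def IsHomog (n m : ℕ) (u : V n m) (s : ZMod 2) : Prop :=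
  ∀ a ∈ u.support, par n m a = s

/-- An even superderivation: parity-preserving and `D[u,v] = [Du,v] + [u,Dv]`. -/
def IsEvenDer (n m : ℕ) (D : Module.End ℂ (V n m)) : Prop :=
  (∀ (u : V n m) (s : ZMod 2), IsHomog n m u s → IsHomog n m (D u) s) ∧
  (∀ u v : V n m, D (br n m u v) = br n m (D u) v + br n m u (D v))

/-- An odd superderivation: parity-reversing and
`D[u,v] = [Du,v] + (-1)^{|u|}[u,Dv]` for homogeneous `u`. -/
def IsOddDer (n m : ℕ) (D : Module.End ℂ (V n m)) : Prop :=
  (∀ (u : V n m) (s : ZMod 2), IsHomog n m u s → IsHomog n m (D u) (s + 1)) ∧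
  (∀ (u v : V n m) (su : ZMod 2), IsHomog n m u su →
    D (br n m u v) = br n m (D u) v + ((-1 : ℂ) ^ su.val) • br n m u (D v))

lemma br_basis (n m : ℕ) (a b : Idx n m) :
    br n m (Finsupp.single a 1) (Finsupp.single b 1) = c n m a b := by
  simp [br, brL]

lemma X_eq (n m : ℕ) (i : Fin n) : X n m (i.val + 1) = Finsupp.single (Sum.inl i) 1 := by
  have : 1 ≤ i.val + 1 ∧ i.val + 1 ≤ n := ⟨by omega, i.2⟩
  simp [X]

lemma Y_eq (n m : ℕ) (i : Fin m) :
    Y n m (i.val + 1) = Finsupp.single (Sum.inr (Sum.inr i)) 1 := by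
  simp [Y]

lemma T_eq (n m : ℕ) (i : Fin 3) :
    T n m (i.val + 1) = Finsupp.single (Sum.inr (Sum.inl i)) 1 := by
  have : i.val + 1 ≤ 3 := i.2
  simp [T, this]

lemma X_zero (n m k : ℕ) (h : n < k) : X n m k = 0 := by
  unfold X; rw [dif_neg]; omega

lemma Y_zero (n m k : ℕ) (h : m < k) : Y n m k = 0 := by
  unfold Y; rw [dif_neg]; omega

lemma X_cases (n m k : ℕ) (h : 1 ≤ k) :
    X n m k = 0 ∧ n < k ∨ ∃ i : Fin n, k = i.val + 1 ∧ X n m k = Finsupp.single (Sum.inl i) 1 := by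
  by_cases hk : k ≤ n
  · refine Or.inr ⟨⟨k - 1, by omega⟩, by simp; omega, ?_⟩
    rw [← X_eq]; congr 1; simp; omega
  · exact Or.inl ⟨X_zero _ _ _ (by omega), by omega⟩

lemma Y_cases (n m k : ℕ) (h : 1 ≤ k) :
    Y n m k = 0 ∧ m < k ∨
      ∃ i : Fin m, k = i.val + 1 ∧ Y n m k = Finsupp.single (Sum.inr (Sum.inr i)) 1 := by
  by_cases hk : k ≤ m
  · refine Or.inr ⟨⟨k - 1, by omega⟩, by simp; omega, ?_⟩
    rw [← Y_eq]; congr 1; simp; omega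
  · exact Or.inl ⟨Y_zero _ _ _ (by omega), by omega⟩

lemma br_zl (n m : ℕ) (v : V n m) : br n m 0 v = 0 := by simp [br]
lemma br_zr (n m : ℕ) (v : V n m) : br n m v 0 = 0 := by simp [br]
lemma br_nl (n m : ℕ) (u v : V n m) : br n m (-u) v = -br n m u v := by simp [br]
lemma br_nr (n m : ℕ) (u v : V n m) : br n m u (-v) = -br n m u v := by simp [br]
lemma br_sl (n m : ℕ) (r : ℂ) (u v : V n m) : br n m (r • u) v = r • br n m u v := by simp [br]
lemma br_sr (n m : ℕ) (r : ℂ) (u v : V n m) : br n m u (r • v) = r • br n m u v := by simp [br]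

lemma br_YX (n m k l : ℕ) (hk : 1 ≤ k) (hl : 1 ≤ l) (hn : 3 ≤ n) :
    br n m (Y n m k) (X n m l) = if l = 1 then -Y n m (k + 1) else 0 := by
  rcases Y_cases n m k hk with ⟨h, h'⟩ | ⟨i, rfl, h⟩
  · rw [h, br_zl, Y_zero n m (k+1) (by omega)]; simp
  rcases X_cases n m l hl with ⟨g, g'⟩ | ⟨j, rfl, g⟩
  · rw [g, br_zr, if_neg (by omega)]
  rw [g, h, br_basis]; simp [c]

lemma br_XY (n m k l : ℕ) (hk : 1 ≤ k) (hl : 1 ≤ l) (hn : 3 ≤ n) :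
    br n m (X n m l) (Y n m k) = if l = 1 then Y n m (k + 1) else 0 := by
  rcases Y_cases n m k hk with ⟨h, h'⟩ | ⟨i, rfl, h⟩
  · rw [h, br_zr, Y_zero n m (k+1) (by omega)]; simp
  rcases X_cases n m l hl with ⟨g, g'⟩ | ⟨j, rfl, g⟩
  · rw [g, br_zl, if_neg (by omega)]
  rw [g, h, br_basis]; simp [c]

lemma br_YY (n m k l : ℕ) (hk : 1 ≤ k) (hl : 1 ≤ l) :
    br n m (Y n m k) (Y n m l) = 0 := by
  rcases Y_cases n m k hk with ⟨h, h'⟩ | ⟨i, rfl, h⟩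
  · rw [h, br_zl]
  rcases Y_cases n m l hl with ⟨g, g'⟩ | ⟨j, rfl, g⟩
  · rw [g, br_zr]
  rw [g, h, br_basis]; simp [c]

/-- weight of `y_k` under `t_{s+1}` -/
noncomputable def wt (s : Fin 3) (k : ℕ) : ℂ := if s = 0 then k else if s = 2 then 1 else 0

lemma br_TY (n m k : ℕ) (s : Fin 3) (hk : 1 ≤ k) :
    br n m (T n m (s.val + 1)) (Y n m k) = wt s k • Y n m k := by
  rcases Y_cases n m k hk with ⟨h, h'⟩ | ⟨i, rfl, h⟩
  · rw [h, br_zr, smul_zero]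
  rw [h, T_eq, br_basis, ← h]; fin_cases s <;> simp [c, wt]

lemma br_YT (n m k : ℕ) (s : Fin 3) (hk : 1 ≤ k) :
    br n m (Y n m k) (T n m (s.val + 1)) = -(wt s k • Y n m k) := by
  rcases Y_cases n m k hk with ⟨h, h'⟩ | ⟨i, rfl, h⟩
  · rw [h, br_zl, smul_zero, neg_zero]
  rw [h, T_eq, br_basis, ← h]; fin_cases s <;> simp [c, wt]

/-- weight of `x_k` under `t_{s+1}` -/
noncomputable def wx (s : Fin 3) (k : ℕ) : ℂ := if s = 0 then k else if s = 1 ∧ 2 ≤ k then 1 else 0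

lemma br_TX (n m k : ℕ) (s : Fin 3) (hk : 1 ≤ k) :
    br n m (T n m (s.val + 1)) (X n m k) = wx s k • X n m k := by
  rcases X_cases n m k hk with ⟨h, h'⟩ | ⟨i, rfl, h⟩
  · rw [h, br_zr, smul_zero]
  rw [h, T_eq, br_basis, ← h]
  fin_cases s <;> simp [c, wx, Nat.one_le_iff_ne_zero]

lemma br_XT (n m k : ℕ) (s : Fin 3) (hk : 1 ≤ k) :
    br n m (X n m k) (T n m (s.val + 1)) = -(wx s k • X n m k) := by
  rcases X_cases n m k hk with ⟨h, h'⟩ | ⟨i, rfl, h⟩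
  · rw [h, br_zl, smul_zero, neg_zero]
  rw [h, T_eq, br_basis, ← h]
  fin_cases s <;> simp [c, wx, Nat.one_le_iff_ne_zero]

lemma br_TT (n m : ℕ) (s t : Fin 3) :
    br n m (T n m (s.val + 1)) (T n m (t.val + 1)) = 0 := by
  rw [T_eq, T_eq, br_basis]; simp [c]

lemma br_XX (n m k l : ℕ) (hk : 1 ≤ k) (hl : 1 ≤ l) (hn : 3 ≤ n) :
    br n m (X n m k) (X n m l) =
      if k = 1 ∧ 2 ≤ l then X n m (l + 1) else if l = 1 ∧ 2 ≤ k then -X n m (k + 1) else 0 := by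
  rcases X_cases n m k hk with ⟨h, h'⟩ | ⟨i, rfl, h⟩
  · rw [h, br_zl, X_zero n m (k+1) (by omega), if_neg (by omega)]; simp
  rcases X_cases n m l hl with ⟨g, g'⟩ | ⟨j, rfl, g⟩
  · rw [g, br_zr, X_zero n m (l+1) (by omega), if_neg (c := _ = 1 ∧ 2 ≤ i.val + 1) (by omega)]; simp
  rw [g, h, br_basis]; simp [c, Nat.one_le_iff_ne_zero]

lemma hom_ext (n m : ℕ) {W : Type*} [AddCommMonoid W] [Module ℂ W] (f g : V n m →ₗ[ℂ] W)
    (hx : ∀ k, 1 ≤ k → k ≤ n → f (X n m k) = g (X n m k))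
    (ht : ∀ s : Fin 3, f (T n m (s.val + 1)) = g (T n m (s.val + 1)))
    (hy : ∀ k, 1 ≤ k → k ≤ m → f (Y n m k) = g (Y n m k)) : f = g := by
  apply Finsupp.lhom_ext'
  intro a
  apply LinearMap.ext_ring
  rcases a with i | s | j
  · simpa [← X_eq] using hx (i.val + 1) (by omega) i.2
  · simpa [← T_eq] using ht s
  · simpa [← Y_eq] using hy (j.val + 1) (by omega) j.2

/-- sign operator -/
noncomputable def sgn (n m : ℕ) : V n m →ₗ[ℂ] V n m :=
  Finsupp.lsum ℂ (fun a => LinearMap.toSpanSingleton ℂ (V n m)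
    ((-1 : ℂ) ^ (par n m a).val • Finsupp.single a 1))

lemma homog_mem (n m : ℕ) (u : V n m) (s : ZMod 2) (h : IsHomog n m u s) :
    u ∈ Submodule.span ℂ ((fun a => Finsupp.single a (1 : ℂ)) '' {a | par n m a = s}) := by
  rw [← Finsupp.supported_eq_span_single, Finsupp.mem_supported]
  exact fun a ha => h a ha

lemma homog_ext (n m : ℕ) (u : V n m) (s : ZMod 2) (h : IsHomog n m u s) 
    (f g : V n m →ₗ[ℂ] V n m)
    (H : ∀ a, par n m a = s → f (Finsupp.single a 1) = g (Finsupp.single a 1)) : f u = g u := by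
  refine LinearMap.eqOn_span (f := f) (g := g) ?_ (homog_mem n m u s h)
  rintro _ ⟨a, ha, rfl⟩
  exact H a ha

lemma sgn_homog (n m : ℕ) (u : V n m) (s : ZMod 2) (h : IsHomog n m u s) :
    sgn n m u = (-1 : ℂ) ^ s.val • u := by
  refine homog_ext n m u s h (sgn n m) ((-1 : ℂ) ^ s.val • LinearMap.id) ?_
  intro a ha
  simp [sgn, ha]

lemma odd_ext (n m : ℕ) (u : V n m) (h : IsHomog n m u 1) (f g : V n m →ₗ[ℂ] V n m)
    (H : ∀ k, 1 ≤ k → k ≤ m → f (Y n m k) = g (Y n m k)) : f u = g u := by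
  refine homog_ext n m u 1 h f g ?_
  rintro (i | s | j) ha
  · simp [par] at ha
  · simp [par] at ha
  · rw [← Y_eq]; exact H _ (by omega) j.2

lemma even_ext (n m : ℕ) (u : V n m) (h : IsHomog n m u 0) (f g : V n m →ₗ[ℂ] V n m)
    (hx : ∀ k, 1 ≤ k → k ≤ n → f (X n m k) = g (X n m k))
    (ht : ∀ s : Fin 3, f (T n m (s.val + 1)) = g (T n m (s.val + 1))) : f u = g u := by
  refine homog_ext n m u 0 h f g ?_
  rintro (i | s | j) ha
  · rw [← X_eq]; exact hx _ (by omega) i.2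
  · rw [← T_eq]; exact ht s
  · simp [par] at ha

lemma homog_single (n m : ℕ) (a : Idx n m) (s : ZMod 2) (h : par n m a = s) :
    IsHomog n m (Finsupp.single a 1) s := by
  intro b hb
  rw [Finsupp.support_single_ne_zero _ one_ne_zero, Finset.mem_singleton] at hb
  rw [hb, h]

lemma homog_X (n m k : ℕ) (hk : 1 ≤ k) : IsHomog n m (X n m k) 0 := by
  rcases X_cases n m k hk with ⟨h, h'⟩ | ⟨i, rfl, h⟩
  · rw [h]; intro a; simp
  · rw [h]; exact homog_single _ _ _ _ rfl

lemma homog_Y (n m k : ℕ) (hk : 1 ≤ k) : IsHomog n m (Y n m k) 1 := by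
  rcases Y_cases n m k hk with ⟨h, h'⟩ | ⟨i, rfl, h⟩
  · rw [h]; intro a; simp
  · rw [h]; exact homog_single _ _ _ _ rfl

lemma homog_T (n m : ℕ) (s : Fin 3) : IsHomog n m (T n m (s.val + 1)) 0 := by
  rw [T_eq]; exact homog_single _ _ _ _ rfl

lemma homog_iff (n m : ℕ) (u : V n m) (s : ZMod 2) :
    IsHomog n m u s ↔ u ∈ Finsupp.supported ℂ ℂ {a | par n m a = s} := by
  rw [Finsupp.mem_supported]; rfl

lemma homog_of_basis (n m : ℕ) (D : V n m →ₗ[ℂ] V n m) (s t : ZMod 2)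
    (H : ∀ a, par n m a = s → IsHomog n m (D (Finsupp.single a 1)) t) (u : V n m)
    (h : IsHomog n m u s) : IsHomog n m (D u) t := by
  rw [homog_iff]
  have : Submodule.span ℂ ((fun a => Finsupp.single a (1 : ℂ)) '' {a | par n m a = s}) ≤
      (Finsupp.supported ℂ ℂ {a | par n m a = t}).comap D := by
    rw [Submodule.span_le]
    rintro _ ⟨a, ha, rfl⟩
    exact (homog_iff _ _ _ _).1 (H a ha)
  exact this (homog_mem n m u s h)

lemma homog_smul (n m : ℕ) (r : ℂ) (u : V n m) (s : ZMod 2) (h : IsHomog n m u s) :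
    IsHomog n m (r • u) s := by
  rw [homog_iff] at *; exact Submodule.smul_mem _ _ h

lemma homog_neg (n m : ℕ) (u : V n m) (s : ZMod 2) (h : IsHomog n m u s) :
    IsHomog n m (-u) s := by
  rw [homog_iff] at *; exact Submodule.neg_mem _ h

lemma homog_zero (n m : ℕ) (s : ZMod 2) : IsHomog n m 0 s := by
  rw [homog_iff] at *; exact Submodule.zero_mem _

lemma sgn_X (n m k : ℕ) (hk : 1 ≤ k) : sgn n m (X n m k) = X n m k := by
  rw [sgn_homog _ _ _ _ (homog_X n m k hk)]; simp
lemma sgn_T (n m : ℕ) (s : Fin 3) : sgn n m (T n m (s.val + 1)) = T n m (s.val + 1) := by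
  rw [sgn_homog _ _ _ _ (homog_T n m s)]; simp
lemma sgn_Y (n m k : ℕ) (hk : 1 ≤ k) : sgn n m (Y n m k) = -Y n m k := by
  rw [sgn_homog _ _ _ _ (homog_Y n m k hk)]; simp [ZMod.val_one]

lemma ad_leibniz (n m k : ℕ) (hn : 3 ≤ n) (hk : 1 ≤ k) (u v : V n m) :
    br n m (Y n m k) (br n m u v) =
      br n m (br n m (Y n m k) u) v + br n m (sgn n m u) (br n m (Y n m k) v) := by
  let A := brL n m (Y n m k)
  have key : (brL n m).compr₂ A = (brL n m) ∘ₗ A + ((brL n m).compl₂ A) ∘ₗ (sgn n m) := by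
    apply hom_ext
    · intro i hi _
      apply hom_ext
      · intro j hj _
        change br n m (Y n m k) (br n m _ _) = br n m (br n m (Y n m k) _) _ + br n m (sgn n m _) (br n m (Y n m k) _)
        rw [sgn_X _ _ _ hi, br_XX _ _ _ _ hi hj hn, br_YX _ _ _ _ hk hi hn, br_YX _ _ _ _ hk hj hn]
        split_ifs <;> first | omega | (simp [br_nl, br_nr, br_zl, br_zr, br_YX, br_XY, hk, hi, hj, hn, *])
        all_goals first | omega | simp
      · intro s
        change br n m (Y n m k) (br n m _ _) = br n m (br n m (Y n m k) _) _ + br n m (sgn n m _) (br n m (Y n m k) _)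
        rw [sgn_X _ _ _ hi, br_XT _ _ _ _ hi, br_YX _ _ _ _ hk hi hn, br_YT _ _ _ _ hk, br_nr, br_nr, br_sr, br_sr,
          br_YX _ _ _ _ hk hi hn, br_XY _ _ _ _ hk hi hn]
        split_ifs with h
        · subst h
          rw [br_nl, br_YT _ _ _ _ (by omega)]
          fin_cases s <;> simp [wt, wx]
          module
        · simp [br_zl]
      · intro j hj _
        change br n m (Y n m k) (br n m _ _) = br n m (br n m (Y n m k) _) _ + br n m (sgn n m _) (br n m (Y n m k) _)
        rw [br_YY _ _ _ _ hk hj, br_XY _ _ _ _ hj hi hn, br_YX _ _ _ _ hk hi hn, br_zr]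
        split_ifs <;> simp [br_nl, br_YY, hk, hj, br_zr, br_zl]
    · intro s
      apply hom_ext
      · intro j hj _
        change br n m (Y n m k) (br n m _ _) = br n m (br n m (Y n m k) _) _ + br n m (sgn n m _) (br n m (Y n m k) _)
        rw [sgn_T, br_TX _ _ _ _ hj, br_YX _ _ _ _ hk hj hn, br_YT _ _ _ _ hk, br_nl, br_sr, br_sl,
          br_YX _ _ _ _ hk hj hn]
        split_ifs with h
        · subst h
          rw [br_nr, br_TY _ _ _ _ (by omega)]
          fin_cases s <;> simp [wt, wx]
          module
        · simp [br_zr]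
      · intro t
        change br n m (Y n m k) (br n m _ _) = br n m (br n m (Y n m k) _) _ + br n m (sgn n m _) (br n m (Y n m k) _)
        rw [sgn_T, br_TT, br_YT _ _ _ _ hk, br_YT _ _ _ _ hk, br_zr, br_nl, br_nr, br_sl, br_sr, br_YT _ _ _ _ hk,
          br_TY _ _ _ _ hk]
        module
      · intro j hj _
        change br n m (Y n m k) (br n m _ _) = br n m (br n m (Y n m k) _) _ + br n m (sgn n m _) (br n m (Y n m k) _)
        rw [br_YY _ _ _ _ hk hj, br_TY _ _ _ _ hj, br_YT _ _ _ _ hk, br_zr, br_sr, br_nl, br_sl, br_YY _ _ _ _ hk hj]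
        simp
    · intro i hi _
      apply hom_ext
      · intro j hj _
        change br n m (Y n m k) (br n m _ _) = br n m (br n m (Y n m k) _) _ + br n m (sgn n m _) (br n m (Y n m k) _)
        rw [sgn_Y _ _ _ hi, br_YY _ _ _ _ hk hi, br_YX _ _ _ _ hi hj hn, br_YX _ _ _ _ hk hj hn]
        split_ifs <;> simp [br_nl, br_nr, br_YY, hk, hi, br_zr, br_zl]
      · intro t
        change br n m (Y n m k) (br n m _ _) = br n m (br n m (Y n m k) _) _ + br n m (sgn n m _) (br n m (Y n m k) _)
        rw [sgn_Y _ _ _ hi, br_YY _ _ _ _ hk hi, br_YT _ _ _ _ hi, br_YT _ _ _ _ hk]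
        simp [br_nl, br_nr, br_sr, br_YY, hk, hi, br_zl]
      · intro j hj _
        change br n m (Y n m k) (br n m _ _) = br n m (br n m (Y n m k) _) _ + br n m (sgn n m _) (br n m (Y n m k) _)
        simp [br_YY, hk, hi, hj, br_zr, br_zl]
  exact LinearMap.congr_fun (LinearMap.congr_fun key u) v

lemma ad_odd (n m k : ℕ) (hn : 3 ≤ n) (hk : 1 ≤ k) : IsOddDer n m (brL n m (Y n m k)) := by
  constructor
  · intro u s h
    refine homog_of_basis n m _ s (s + 1) ?_ u h
    rintro (i | t | j) rfl
    · rw [← X_eq]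
      change IsHomog n m (br n m _ _) 1
      rw [br_YX _ _ _ _ hk (by omega) hn]
      split_ifs
      · exact homog_neg _ _ _ _ (homog_Y _ _ _ (by omega))
      · exact homog_zero _ _ _
    · rw [← T_eq]
      change IsHomog n m (br n m _ _) 1
      rw [br_YT _ _ _ _ hk]
      exact homog_neg _ _ _ _ (homog_smul _ _ _ _ _ (homog_Y _ _ _ hk))
    · rw [← Y_eq]
      change IsHomog n m (br n m _ _) _
      rw [br_YY _ _ _ _ hk (by omega)]
      exact homog_zero _ _ _
  · intro u v s h
    have := ad_leibniz n m k hn hk u v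
    rw [sgn_homog n m u s h, br_sl] at this
    exact this

lemma odd_sum (n m : ℕ) (u : V n m) (h : IsHomog n m u 1) :
    ∃ w : ℕ → ℂ, u = ∑ k ∈ Finset.Icc 1 m, w k • Y n m k := by
  have : Submodule.span ℂ ((fun a => Finsupp.single a (1 : ℂ)) '' {a | par n m a = 1}) ≤
      Submodule.span ℂ ((Y n m) '' (Finset.Icc 1 m : Finset ℕ)) := by
    apply Submodule.span_mono
    rintro _ ⟨i | s | j, ha, rfl⟩
    · simp [par] at ha
    · simp [par] at ha
    · exact ⟨j.val + 1, by simp [j.2], Y_eq n m j⟩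
  have h2 := this (homog_mem n m u 1 h)
  rw [Submodule.mem_span_image_finset_iff_exists_fun] at h2
  obtain ⟨w, hw⟩ := h2
  refine ⟨fun k => if hk : k ∈ Finset.Icc 1 m then w ⟨k, hk⟩ else 0, ?_⟩
  rw [← hw, ← Finset.sum_coe_sort (Finset.Icc 1 m)]
  refine Finset.sum_congr rfl fun i _ => ?_
  simp only [dif_pos i.2]

lemma odd_Y (n m : ℕ) (u : V n m) (hu : IsHomog n m u 1) (k : ℕ) (hk : 1 ≤ k) :
    br n m u (Y n m k) = 0 := by
  have := odd_ext n m u hu ((brL n m).flip (Y n m k)) 0 (fun j hj _ => by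
    rw [LinearMap.flip_apply, LinearMap.zero_apply]
    exact br_YY n m j k hj hk)
  rwa [LinearMap.flip_apply, LinearMap.zero_apply] at this

lemma odd_X (n m : ℕ) (hn : 3 ≤ n) (u : V n m) (hu : IsHomog n m u 1) (k : ℕ) (hk : 2 ≤ k) :
    br n m u (X n m k) = 0 := by
  have := odd_ext n m u hu ((brL n m).flip (X n m k)) 0 (fun j hj _ => by
    have := br_YX n m j k hj (by omega) hn
    rw [if_neg (by omega)] at this
    rw [LinearMap.flip_apply, LinearMap.zero_apply]
    exact this)
  rwa [LinearMap.flip_apply, LinearMap.zero_apply] at this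

lemma odd_T2 (n m : ℕ) (u : V n m) (hu : IsHomog n m u 1) : br n m (T n m 2) u = 0 := by
  have := odd_ext n m u hu (brL n m (T n m 2)) 0 (fun j hj _ => by
    have := br_TY n m j 1 hj
    simp [wt] at this
    rw [LinearMap.zero_apply]
    exact this)
  rwa [LinearMap.zero_apply] at this

lemma odd_T3 (n m : ℕ) (u : V n m) (hu : IsHomog n m u 1) : br n m (T n m 3) u = u := by
  have := odd_ext n m u hu (brL n m (T n m 3)) LinearMap.id (fun j hj _ => by
    have := br_TY n m j 2 hj
    simp [wt] at this
    rw [LinearMap.id_apply]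
    exact this)
  rwa [LinearMap.id_apply] at this

lemma even_T3 (n m : ℕ) (u : V n m) (hu : IsHomog n m u 0) : br n m (T n m 3) u = 0 := by
  have := even_ext n m u hu (brL n m (T n m 3)) 0
    (fun k hk _ => by
      have := br_TX n m k 2 hk
      simp [wx] at this
      rw [LinearMap.zero_apply]
      exact this)
    (fun s => by
      rw [LinearMap.zero_apply]
      exact br_TT n m 2 s)
  rwa [LinearMap.zero_apply] at this

lemma der_inner (n m : ℕ) (hn : 3 ≤ n) (D : Module.End ℂ (V n m)) (hD : IsOddDer n m D) :
    D = -brL n m (D (T n m 3)) := by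
  obtain ⟨hp, hL⟩ := hD
  have hT : ∀ s : Fin 3, IsHomog n m (D (T n m (s.val + 1))) 1 := fun s => by
    simpa using hp _ _ (homog_T n m s)
  have hX : ∀ k, 1 ≤ k → IsHomog n m (D (X n m k)) 1 := fun k hk => by
    simpa using hp _ _ (homog_X n m k hk)
  have hY : ∀ k, 1 ≤ k → IsHomog n m (D (Y n m k)) 0 := fun k hk => by
    have := hp _ _ (homog_Y n m k hk)
    rwa [show (1 : ZMod 2) + 1 = 0 from rfl] at this
  have L : ∀ (s : Fin 3) v, D (br n m (T n m (s.val + 1)) v) =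
      br n m (D (T n m (s.val + 1))) v + br n m (T n m (s.val + 1)) (D v) := fun s v => by
    simpa using hL _ v 0 (homog_T n m s)
  have oY := odd_Y n m
  have oX := odd_X n m hn
  have oT2 := odd_T2 n m
  have oT3 := odd_T3 n m
  have eT3 := even_T3 n m
  have h3 : IsHomog n m (D (T n m 3)) 1 := hT 2
  have h2 : IsHomog n m (D (T n m 2)) 1 := hT 1
  apply hom_ext
  · intro k hk hkn
    change _ = -br n m _ _
    by_cases h : k = 1
    · subst h
      have a := L 2 (X n m 1)
      rw [br_TX _ _ _ _ hk] at a
      simp [wx] at a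
      rw [oT3 _ (hX 1 hk)] at a
      exact eq_neg_of_add_eq_zero_right a.symm
    · have a := L 1 (X n m k)
      rw [br_TX _ _ _ _ hk] at a
      have : 2 ≤ k := by omega
      simp [wx, this] at a
      rw [oT2 _ (hX k hk), oX _ h2 k this] at a
      rw [oX _ h3 k this, a]; simp
  · intro s
    change _ = -br n m _ _
    have a := L 2 (T n m (s.val + 1))
    rw [br_TT, map_zero] at a
    change 0 = br n m (D (T n m 3)) _ + br n m (T n m 3) _ at a
    rw [oT3 _ (hT s)] at a
    exact eq_neg_of_add_eq_zero_right a.symm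
  · intro k hk _
    change _ = -br n m _ _
    have a := L 2 (Y n m k)
    rw [br_TY _ _ _ _ hk] at a
    simp [wt] at a
    rw [oY _ h3 k hk, eT3 _ (hY k hk)] at a
    rw [oY _ h3 k hk, a]; simp

lemma der_form (n m : ℕ) (hn : 3 ≤ n) (D : Module.End ℂ (V n m)) (hD : IsOddDer n m D) :
    ∃ w : ℕ → ℂ, D = -∑ k ∈ Finset.Icc 1 m, w k • brL n m (Y n m k) := by
  have h3 : IsHomog n m (D (T n m 3)) 1 := by
    simpa using hD.1 _ _ (homog_T n m 2)
  obtain ⟨w, hw⟩ := odd_sum n m _ h3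
  refine ⟨w, ?_⟩
  rw [der_inner n m hn D hD, hw]
  simp

/-- Classification of odd superderivations of `SL^{n,m}`: each has the displayed form,
is inner (`D = -Σ_{k=1}^{m-1} a_{k+1}·ad(y_k) - h_m·ad(y_m)`), and
`dim Der₁(SL^{n,m}) = m`. -/
theorem oddSuperderivations_SL (n m : ℕ) (hn : 3 ≤ n) (hm : 2 ≤ m) :
    (∀ D : Module.End ℂ (V n m), IsOddDer n m D →
      ∃ (a : ℕ → ℂ) (hM : ℂ),
        D (X n m 1) = ∑ k ∈ Finset.Icc 2 m, a k • Y n m k ∧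
        (∀ i : ℕ, 2 ≤ i → i ≤ n → D (X n m i) = 0) ∧
        (∀ j : ℕ, 1 ≤ j → j ≤ m → D (Y n m j) = 0) ∧
        D (T n m 1) = (∑ k ∈ Finset.Icc 1 (m - 1), ((k : ℂ) * a (k + 1)) • Y n m k) +
            ((m : ℂ) * hM) • Y n m m ∧
        D (T n m 2) = 0 ∧
        D (T n m 3) = (∑ k ∈ Finset.Icc 1 (m - 1), a (k + 1) • Y n m k) + hM • Y n m m ∧
        (∀ w : V n m,
          D w = -(∑ k ∈ Finset.Icc 1 (m - 1), a (k + 1) • br n m (Y n m k) w)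
            - hM • br n m (Y n m m) w)) ∧
    (∃ B : Fin m → Module.End ℂ (V n m),
      LinearIndependent ℂ B ∧ (∀ i, IsOddDer n m (B i)) ∧
      ∀ D : Module.End ℂ (V n m), IsOddDer n m D → D ∈ Submodule.span ℂ (Set.range B)) := by
  constructor
  · intro D hD
    obtain ⟨w, hw⟩ := der_form n m hn D hD
    have split : ∀ f : ℕ → V n m, ∑ k ∈ Finset.Icc 1 m, f k =
        ∑ k ∈ Finset.Icc 1 (m - 1), f k + f m := by
      intro f
      obtain ⟨p, rfl⟩ : ∃ p, m = p + 1 := ⟨m - 1, by omega⟩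
      rw [Finset.sum_Icc_succ_top (by omega)]; simp
    have hv : ∀ v, D v = -∑ k ∈ Finset.Icc 1 m, w k • br n m (Y n m k) v := by
      intro v; rw [hw]; simp [br]
    have hT : ∀ s : Fin 3, D (T n m (s.val + 1)) =
        ∑ k ∈ Finset.Icc 1 m, (wt s k * w k) • Y n m k := by
      intro s
      rw [hv, ← Finset.sum_neg_distrib]
      refine Finset.sum_congr rfl fun k hk => ?_
      rw [br_YT _ _ _ _ (Finset.mem_Icc.1 hk).1]
      module
    refine ⟨fun k => w (k - 1), w m, ?_, ?_, ?_, ?_, ?_, ?_, ?_⟩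
    · rw [hv, split, br_YX _ _ _ _ (by omega) le_rfl hn, Y_zero n m (m + 1) (by omega)]
      simp only [if_true, neg_zero, smul_zero, add_zero]
      rw [← Finset.sum_neg_distrib]
      refine Finset.sum_bij' (fun k _ => k + 1) (fun k _ => k - 1) ?_ ?_ ?_ ?_ ?_
      · intro k hk; simp only [Finset.mem_Icc] at *; omega
      · intro k hk; simp only [Finset.mem_Icc] at *; omega
      · intro k hk; simp
      · intro k hk; simp only [Finset.mem_Icc] at *; omega
      · intro k hk
        rw [br_YX _ _ _ _ (Finset.mem_Icc.1 hk).1 le_rfl hn]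
        simp
    · intro i hi _
      rw [hv, neg_eq_zero]
      refine Finset.sum_eq_zero fun k hk => ?_
      rw [br_YX _ _ _ _ (Finset.mem_Icc.1 hk).1 (by omega) hn, if_neg (by omega), smul_zero]
    · intro j hj _
      rw [hv, neg_eq_zero]
      refine Finset.sum_eq_zero fun k hk => ?_
      rw [br_YY _ _ _ _ (Finset.mem_Icc.1 hk).1 hj, smul_zero]
    · have := hT 0
      rw [split] at this
      simpa [wt] using this
    · have := hT 1
      simpa [wt] using this
    · have := hT 2
      rw [split] at this
      simpa [wt] using this
    · intro v
      rw [hv, split]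
      simp only [Nat.add_sub_cancel]
      abel
  · refine ⟨fun i => brL n m (Y n m (i.val + 1)), ?_, fun i => ad_odd n m _ hn (by omega), ?_⟩
    · let f : Module.End ℂ (V n m) →ₗ[ℂ] V n m := -(LinearMap.applyₗ (R := ℂ) (M₂ := V n m) (T n m 3))
      apply LinearIndependent.of_comp f
      have e : (f ∘ fun i : Fin m => brL n m (Y n m (i.val + 1))) =
          (fun a : Idx n m => Finsupp.single a (1 : ℂ)) ∘ (fun i : Fin m => Sum.inr (Sum.inr i)) := by
        funext i
        change -br n m _ (T n m ((2 : Fin 3).val + 1)) = Finsupp.single _ 1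
        rw [br_YT _ _ _ _ (by omega), ← Y_eq]
        simp [wt]
      rw [e]
      apply LinearIndependent.comp (Finsupp.linearIndependent_single_one ℂ (Idx n m))
      intro i j h
      simpa using h
    · intro D hD
      obtain ⟨w, hw⟩ := der_form n m hn D hD
      have hw' : D = ∑ k ∈ Finset.Icc 1 m, (-w k) • brL n m (Y n m k) := by
        refine LinearMap.ext fun v => ?_
        rw [hw]; simp
      rw [hw']
      apply Submodule.sum_mem
      intro k hk
      apply Submodule.smul_mem
      apply Submodule.subset_span
      rw [Finset.mem_Icc] at hk
      exact ⟨⟨k - 1, by omega⟩, by simp only; rw [Nat.sub_add_cancel hk.1]⟩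

end SolvableModelFiliform
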